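/- arXiv:2007.11844 — 2 statements merged into one kernel-verified Lean document; each statement's English description precedes it below -/
import Mathlib

section
/- Let G be a cograph with diameter 2 belonging to 𝒢₁(n, n−3) with n ≥ 5, and let P₃ = v₁v₂v₃ be a diametrical path of G (so v₁ and v₃ are at distance 2). Then S_{{v₁}} = S_{{v₂}} = S_{{v₃}} = ∅. -/
open Matrix

/-- The normalized Laplacian matrix of a finite simple graph. -/
noncomputable def normLap {V : Type*} [Fintype V] [DecidableEq V] (G : SimpleGraph V) [DecidableRel G.Adj] :
    Matrix V V ℝ :=
  Matrix.of fun u v =>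
    if u = v then 1
    else if G.Adj u v then -1 / Real.sqrt ((G.degree u : ℝ) * (G.degree v : ℝ))
    else 0

/-- The (geometric) multiplicity of `μ` as an eigenvalue of the matrix `M`. -/
noncomputable def eigMult {V : Type*} [Fintype V] [DecidableEq V]
    (M : Matrix V V ℝ) (μ : ℝ) : ℕ :=
  Module.finrank ℝ (LinearMap.ker (M - μ • (1 : Matrix V V ℝ)).mulVecLin)

/-- The multiset of eigenvalues (with multiplicity) of a hermitian matrix. -/
noncomputable def eigMultiset {V : Type*} [Fintype V] [DecidableEq V]
    (M : Matrix V V ℝ) : Multiset ℝ :=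
  if h : M.IsHermitian then Finset.univ.val.map h.eigenvalues else 0

/-- The second-smallest eigenvalue (counted with multiplicity) of a hermitian matrix. -/
noncomputable def secondSmallestEig {V : Type*} [Fintype V] [DecidableEq V]
    (M : Matrix V V ℝ) : ℝ :=
  ((eigMultiset M).sort (· ≤ ·)).getD 1 0

/-- The independence number of a finite simple graph. -/
noncomputable def indepNum {V : Type*} [Fintype V] (G : SimpleGraph V) : ℕ :=
  sSup {k | ∃ s : Finset V, (∀ u ∈ s, ∀ v ∈ s, u ≠ v → ¬ G.Adj u v) ∧ s.card = k}

/-- `G ∈ 𝒢₁(n, n-3)`. -/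
def memG1Family {V : Type*} [Fintype V] [DecidableEq V]
    (G : SimpleGraph V) [DecidableRel G.Adj] (n : ℕ) : Prop :=
  G.Connected ∧ Fintype.card V = n ∧
    (∃ θ : ℝ, eigMult (normLap G) θ = n - 3) ∧
    secondSmallestEig (normLap G) ≠ 1 ∧
    indepNum G = 2

/-- `v₁v₂v₃v₄` is an induced path `P₄`. -/
def IsInducedP4 {V : Type*} (G : SimpleGraph V) (v1 v2 v3 v4 : V) : Prop :=
  G.Adj v1 v2 ∧ G.Adj v2 v3 ∧ G.Adj v3 v4 ∧
    ¬ G.Adj v1 v3 ∧ ¬ G.Adj v1 v4 ∧ ¬ G.Adj v2 v4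

/-- A cograph: no induced path on 4 vertices. -/
def IsCograph {V : Type*} (G : SimpleGraph V) : Prop :=
  ∀ a b c d : V, ¬ IsInducedP4 G a b c d

/-- `S_U`: vertices outside the path `P` whose neighborhood inside `P` is exactly `U`. -/
def Sset {V : Type*} (G : SimpleGraph V) (P U : Set V) : Set V :=
  {u | u ∉ P ∧ G.neighborSet u ∩ P = U}

/-- The graph `G₁`: two cliques `A` (of size `a+1`) and `B` (of size `b+1`) forming a complete
graph together, a vertex `u` joined to all of `A` and a vertex `w` joined to all of `B`. -/
def graphG1 (a b : ℕ) : SimpleGraph (Unit ⊕ (Fin (a + 1) ⊕ (Fin (b + 1) ⊕ Unit))) :=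
  SimpleGraph.fromRel fun x y =>
    match x, y with
    | Sum.inl _, Sum.inr (Sum.inl _) => True
    | Sum.inr (Sum.inl _), Sum.inr (Sum.inl _) => True
    | Sum.inr (Sum.inl _), Sum.inr (Sum.inr (Sum.inl _)) => True
    | Sum.inr (Sum.inr (Sum.inl _)), Sum.inr (Sum.inr (Sum.inl _)) => True
    | Sum.inr (Sum.inr (Sum.inl _)), Sum.inr (Sum.inr (Sum.inr _)) => True
    | _, _ => False

noncomputable instance (a b : ℕ) : DecidableRel (graphG1 a b).Adj := Classical.decRel _

/-- The graph `G₂` on `m + 2` vertices: a complete graph on `m + 1` vertices together with a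
pendant vertex attached to one of its vertices. -/
def graphG2 (m : ℕ) : SimpleGraph (Unit ⊕ Fin (m + 1)) :=
  SimpleGraph.fromRel fun x y =>
    match x, y with
    | Sum.inl _, Sum.inr j => j = 0
    | Sum.inr _, Sum.inr _ => True
    | _, _ => False

noncomputable instance (m : ℕ) : DecidableRel (graphG2 m).Adj := Classical.decRel _

/-- The join of a single vertex with the disjoint union of two complete graphs `K_m`. -/
def joinTwoCliques (m : ℕ) : SimpleGraph (Unit ⊕ (Fin m ⊕ Fin m)) :=
  SimpleGraph.fromRel fun x y =>
    match x, y with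
    | Sum.inl _, Sum.inr _ => True
    | Sum.inr (Sum.inl _), Sum.inr (Sum.inl _) => True
    | Sum.inr (Sum.inr _), Sum.inr (Sum.inr _) => True
    | _, _ => False

noncomputable instance (m : ℕ) : DecidableRel (joinTwoCliques m).Adj := Classical.decRel _

/-- An independent set is no larger than the independence number. -/
theorem card_le_indepNum {V : Type*} [Fintype V] {G : SimpleGraph V} {s : Finset V}
    (hs : ∀ u ∈ s, ∀ v ∈ s, u ≠ v → ¬ G.Adj u v) : s.card ≤ indepNum G :=
  le_csSup ⟨Fintype.card V, by rintro k ⟨t, -, rfl⟩; exact t.card_le_univ⟩ ⟨s, hs, rfl⟩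

/-- Membership in `S_U` decides adjacency to each vertex of the path. -/
theorem adj_iff_of_mem_Sset {V : Type*} {G : SimpleGraph V} {P U : Set V} {u x : V}
    (hu : u ∈ Sset G P U) (hx : x ∈ P) : G.Adj u x ↔ x ∈ U := by
  rw [← hu.2]
  simp [hx]

/-- In a cograph, no vertex has an endpoint of an induced `P₃` as its only neighbor on it. -/
theorem IsCograph.Sset_endpoint_eq_empty {V : Type*} {G : SimpleGraph V} (hco : IsCograph G)
    {a b c : V} {P : Set V} (hb : b ∈ P) (ha : a ∈ P) (hc : c ∈ P)
    (hab : G.Adj a b) (hbc : G.Adj b c) (hac : a ≠ c) (hnac : ¬ G.Adj a c) :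
    Sset G P {a} = ∅ := by
  refine Set.eq_empty_of_forall_notMem fun u hu => hco u a b c ⟨?_, hab, hbc, ?_, ?_, hnac⟩
  · exact (adj_iff_of_mem_Sset hu ha).2 rfl
  · exact fun h => hab.ne' ((adj_iff_of_mem_Sset hu hb).1 h)
  · exact fun h => hac.symm ((adj_iff_of_mem_Sset hu hc).1 h)

theorem statement10 {V : Type*} [Fintype V] [DecidableEq V] (n : ℕ) (hn : 5 ≤ n)
    (G : SimpleGraph V) [DecidableRel G.Adj]
    (hG : memG1Family G n) (hco : IsCograph G) (hdiam : G.diam = 2)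
    (v1 v2 v3 : V) (h12 : G.Adj v1 v2) (h23 : G.Adj v2 v3) (hdist : G.dist v1 v3 = 2) :
    Sset G {v1, v2, v3} {v1} = ∅ ∧
    Sset G {v1, v2, v3} {v2} = ∅ ∧
    Sset G {v1, v2, v3} {v3} = ∅ := by
  have hnadj : ¬ G.Adj v1 v3 := fun h => by
    simp [SimpleGraph.dist_eq_one_iff_adj.2 h] at hdist
  have hne : v1 ≠ v3 := by
    rintro rfl
    simp at hdist
  refine ⟨hco.Sset_endpoint_eq_empty (b := v2) (c := v3) (by simp) (by simp) (by simp)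
      h12 h23 hne hnadj, ?_,
    hco.Sset_endpoint_eq_empty (b := v2) (c := v1) (by simp) (by simp) (by simp)
      h23.symm h12.symm hne.symm fun h => hnadj h.symm⟩
  refine Set.eq_empty_of_forall_notMem fun u hu => ?_
  have hu1 : ¬ G.Adj u v1 := fun h => h12.ne ((adj_iff_of_mem_Sset hu (by simp)).1 h)
  have hu3 : ¬ G.Adj u v3 := fun h => h23.ne' ((adj_iff_of_mem_Sset hu (by simp)).1 h)
  have huP : u ≠ v1 ∧ u ≠ v2 ∧ u ≠ v3 := by simpa using hu.1
  have hcard : ({u, v1, v3} : Finset V).card = 3 :=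
    Finset.card_eq_three.2 ⟨u, v1, v3, huP.1, huP.2.2, hne, rfl⟩
  have hle : ({u, v1, v3} : Finset V).card ≤ indepNum G := by
    apply card_le_indepNum
    simp [G.adj_comm _ u, G.adj_comm v3 v1, hu1, hu3, hnadj]
  have hind : indepNum G = 2 := hG.2.2.2.2
  omega
end

section
/- Let G be a cograph with diameter 2 belonging to 𝒢₁(n, n−3) with n ≥ 5, and let P₃ = v₁v₂v₃ be a diametrical path of G (so v₁ and v₃ are at distance 2). If S_{{v₁,v₂}} ≠ ∅, then S_{{v₁,v₃}} = S_{{v₂,v₃}} = S_{{v₁,v₂,v₃}} = ∅. -/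
open Matrix

/-- The matrix `A + s • D`, with `A` the adjacency matrix and `D` the degree matrix of `G`. -/
noncomputable def degShift {V : Type*} [Fintype V] [DecidableEq V] (G : SimpleGraph V)
    [DecidableRel G.Adj] (s : ℝ) : Matrix V V ℝ :=
  Matrix.of fun u v => if u = v then s * G.degree u else if G.Adj u v then 1 else 0

lemma normLap_sub_smul_one {V : Type*} [Fintype V] [DecidableEq V] (G : SimpleGraph V)
    [DecidableRel G.Adj] (hdeg : ∀ v, 0 < G.degree v) (θ : ℝ) :
    Matrix.diagonal (fun v => Real.sqrt (G.degree v)) * (normLap G - θ • (1 : Matrix V V ℝ)) *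
      Matrix.diagonal (fun v => -Real.sqrt (G.degree v)) = degShift G (θ - 1) := by
  ext u v
  have hu : 0 < Real.sqrt (G.degree u) := Real.sqrt_pos.2 (by exact_mod_cast hdeg u)
  have hv : 0 < Real.sqrt (G.degree v) := Real.sqrt_pos.2 (by exact_mod_cast hdeg v)
  rw [Matrix.mul_diagonal, Matrix.diagonal_mul]
  by_cases huv : u = v
  · subst huv
    have := Real.mul_self_sqrt (Nat.cast_nonneg (α := ℝ) (G.degree u))
    simp [normLap, degShift]
    linear_combination (θ - 1) * this
  · by_cases h : G.Adj u v
    · simp [normLap, degShift, huv, h]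
      field_simp
    · simp [normLap, degShift, huv, h]

lemma rank_degShift {V : Type*} [Fintype V] [DecidableEq V] (G : SimpleGraph V)
    [DecidableRel G.Adj] (hdeg : ∀ v, 0 < G.degree v) (θ : ℝ) :
    (degShift G (θ - 1)).rank + eigMult (normLap G) θ = Fintype.card V := by
  have hpos (v : V) : Real.sqrt (G.degree v) ≠ 0 :=
    (Real.sqrt_pos.2 (by exact_mod_cast hdeg v)).ne'
  rw [← normLap_sub_smul_one G hdeg, Matrix.rank_mul_eq_left_of_det_ne_zero,
    Matrix.rank_mul_eq_right_of_isUnit_det]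
  · have := LinearMap.finrank_range_add_finrank_ker (normLap G - θ • (1 : Matrix V V ℝ)).mulVecLin
    rw [Module.finrank_fintype_fun_eq_card] at this
    exact this
  · rw [Matrix.det_diagonal, isUnit_iff_ne_zero]
    exact Finset.prod_ne_zero_iff.2 fun v _ => hpos v
  · rw [Matrix.det_diagonal]
    exact Finset.prod_ne_zero_iff.2 fun v _ => neg_ne_zero.2 (hpos v)

lemma det_submatrix_eq_zero_of_rank_lt {V : Type*} [Fintype V] {M : Matrix V V ℝ} {k : ℕ}
    (h : M.rank < k) (f g : Fin k → V) : (M.submatrix f g).det = 0 := by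
  by_contra hne
  have h1 := Matrix.rank_of_isUnit _ ((Matrix.isUnit_iff_isUnit_det _).2 (isUnit_iff_ne_zero.2 hne))
  have h2 := Matrix.rank_submatrix_le M f g
  rw [Fintype.card_fin] at h1
  omega

lemma det_fin_four_of {R : Type*} [CommRing R] (M : Matrix (Fin 4) (Fin 4) R) :
    M.det =
      M 0 0 * (M 1 1 * (M 2 2 * M 3 3 - M 2 3 * M 3 2) - M 1 2 * (M 2 1 * M 3 3 - M 2 3 * M 3 1)
        + M 1 3 * (M 2 1 * M 3 2 - M 2 2 * M 3 1))
      - M 0 1 * (M 1 0 * (M 2 2 * M 3 3 - M 2 3 * M 3 2) - M 1 2 * (M 2 0 * M 3 3 - M 2 3 * M 3 0)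
        + M 1 3 * (M 2 0 * M 3 2 - M 2 2 * M 3 0))
      + M 0 2 * (M 1 0 * (M 2 1 * M 3 3 - M 2 3 * M 3 1) - M 1 1 * (M 2 0 * M 3 3 - M 2 3 * M 3 0)
        + M 1 3 * (M 2 0 * M 3 1 - M 2 1 * M 3 0))
      - M 0 3 * (M 1 0 * (M 2 1 * M 3 2 - M 2 2 * M 3 1) - M 1 1 * (M 2 0 * M 3 2 - M 2 2 * M 3 0)
        + M 1 2 * (M 2 0 * M 3 1 - M 2 1 * M 3 0)) := by
  rw [Matrix.det_succ_row_zero]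
  simp [Fin.sum_univ_succ, Matrix.det_fin_three, Fin.succAbove]
  ring!

section DegreeLemmas

variable {V : Type*} [Fintype V] [DecidableEq V] {G : SimpleGraph V} [DecidableRel G.Adj]

lemma degree_eq_of_adj_iff {u v : V} (huv : G.Adj u v)
    (h : ∀ w, w ≠ u → w ≠ v → (G.Adj u w ↔ G.Adj v w)) : G.degree u = G.degree v := by
  have he : (G.neighborFinset u).erase v = (G.neighborFinset v).erase u := by
    ext w
    by_cases hu : w = u
    · subst hu; simp
    by_cases hv : w = v
    · subst hv; simp
    simp [hu, hv, h w hu hv]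
  have h1 := Finset.card_erase_add_one ((G.mem_neighborFinset u v).2 huv)
  have h2 := Finset.card_erase_add_one ((G.mem_neighborFinset v u).2 huv.symm)
  rw [he] at h1
  rw [← G.card_neighborFinset_eq_degree u, ← G.card_neighborFinset_eq_degree v, ← h1, ← h2]

lemma degree_add_one_eq_card {u : V} (h : ∀ w, w ≠ u → G.Adj u w) :
    G.degree u + 1 = Fintype.card V := by
  have he : G.neighborFinset u = Finset.univ.erase u := by
    ext w
    by_cases hu : w = u
    · subst hu; simp
    · simp [hu, h w hu]
  rw [← G.card_neighborFinset_eq_degree, he, Finset.card_erase_add_one (Finset.mem_univ u),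
    Finset.card_univ]

lemma degree_add_two_le_card {u v : V} (huv : u ≠ v) (h : ¬ G.Adj u v) :
    G.degree u + 2 ≤ Fintype.card V := by
  have hsub : G.neighborFinset u ⊆ ({u, v} : Finset V)ᶜ := by
    intro w hw
    rw [SimpleGraph.mem_neighborFinset] at hw
    simp only [Finset.mem_compl, Finset.mem_insert, Finset.mem_singleton, not_or]
    exact ⟨hw.ne', fun e => h (e ▸ hw)⟩
  have h1 := Finset.card_le_card hsub
  have h2 := Finset.card_compl_add_card ({u, v} : Finset V)
  rw [Finset.card_pair huv] at h2
  rw [G.card_neighborFinset_eq_degree] at h1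
  omega

lemma degree_add_two_eq_card {u v : V} (huv : u ≠ v) (h : ¬ G.Adj u v)
    (hall : ∀ w, w ≠ u → w ≠ v → G.Adj u w) : G.degree u + 2 = Fintype.card V := by
  have he : G.neighborFinset u = ({u, v} : Finset V)ᶜ := by
    ext w
    simp only [SimpleGraph.mem_neighborFinset, Finset.mem_compl, Finset.mem_insert,
      Finset.mem_singleton, not_or]
    exact ⟨fun hw => ⟨hw.ne', fun e => h (e ▸ hw)⟩, fun hw => hall w hw.1 hw.2⟩
  have h2 := Finset.card_compl_add_card ({u, v} : Finset V)
  rw [Finset.card_pair huv] at h2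
  rw [← G.card_neighborFinset_eq_degree, he, h2]

lemma degree_add_degree_add_two {u v : V} (huv : u ≠ v) (h : ¬ G.Adj u v)
    (hall : ∀ w, w ≠ u → w ≠ v → G.Adj u w ∨ G.Adj v w) :
    G.degree u + G.degree v + 2 =
      Fintype.card V + (G.neighborFinset u ∩ G.neighborFinset v).card := by
  have he : G.neighborFinset u ∪ G.neighborFinset v = ({u, v} : Finset V)ᶜ := by
    ext w
    simp only [Finset.mem_union, SimpleGraph.mem_neighborFinset, Finset.mem_compl,
      Finset.mem_insert, Finset.mem_singleton, not_or]
    constructor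
    · rintro (hw | hw)
      · exact ⟨hw.ne', fun e => h (e ▸ hw)⟩
      · exact ⟨fun e => h (e ▸ hw).symm, hw.ne'⟩
    · exact fun hw => hall w hw.1 hw.2
  have h2 := Finset.card_compl_add_card ({u, v} : Finset V)
  rw [Finset.card_pair huv] at h2
  have h3 := Finset.card_union_add_card_inter (G.neighborFinset u) (G.neighborFinset v)
  rw [he, G.card_neighborFinset_eq_degree, G.card_neighborFinset_eq_degree] at h3
  omega

end DegreeLemmas

/-- A cograph of independence number at most two, without isolated vertices, for which
`A + s • D` has rank three. -/
structure IsRankThreeCograph {V : Type*} [Fintype V] [DecidableEq V] (G : SimpleGraph V)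
    [DecidableRel G.Adj] (s : ℝ) : Prop where
  degree_pos : ∀ v, 0 < G.degree v
  cograph : IsCograph G
  adj_or : ∀ a b c, a ≠ b → a ≠ c → b ≠ c → G.Adj a b ∨ G.Adj a c ∨ G.Adj b c
  rank_eq : (degShift G s).rank = 3

section Minors

variable {V : Type*} [Fintype V] [DecidableEq V] {G : SimpleGraph V} [DecidableRel G.Adj]

lemma degShift_self (s : ℝ) (u : V) : degShift G s u u = s * G.degree u := by simp [degShift]

lemma degShift_adj {s : ℝ} {u v : V} (h : G.Adj u v) : degShift G s u v = 1 := by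
  simp [degShift, h, h.ne]

lemma degShift_adj' {s : ℝ} {u v : V} (h : G.Adj u v) : degShift G s v u = 1 :=
  degShift_adj h.symm

lemma degShift_not_adj {s : ℝ} {u v : V} (hne : u ≠ v) (h : ¬ G.Adj u v) :
    degShift G s u v = 0 := by
  simp [degShift, h, hne]

lemma degShift_not_adj' {s : ℝ} {u v : V} (hne : u ≠ v) (h : ¬ G.Adj u v) :
    degShift G s v u = 0 :=
  degShift_not_adj hne.symm fun e => h e.symm

lemma degShift_comm (s : ℝ) (u v : V) : degShift G s u v = degShift G s v u := by
  by_cases h : u = v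
  · rw [h]
  · simp [degShift, h, Ne.symm h, G.adj_comm]

end Minors

namespace IsRankThreeCograph

variable {V : Type*} [Fintype V] [DecidableEq V] {G : SimpleGraph V} [DecidableRel G.Adj]
  {s : ℝ} {v1 v2 v3 x y : V}

lemma minor (hs : IsRankThreeCograph G s) (f g : Fin 4 → V) :
    ((degShift G s).submatrix f g).det = 0 :=
  det_submatrix_eq_zero_of_rank_lt (by rw [hs.rank_eq]; norm_num) f g

lemma adj_left_or_right (hs : IsRankThreeCograph G s) (hne : v1 ≠ v3) (h13 : ¬ G.Adj v1 v3) (w : V)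
    (h1 : w ≠ v1) (h3 : w ≠ v3) : G.Adj v1 w ∨ G.Adj v3 w := by
  rcases hs.adj_or v1 v3 w hne h1.symm h3.symm with h | h | h
  · exact absurd h h13
  · exact Or.inl h
  · exact Or.inr h

lemma twin (hs : IsRankThreeCograph G s) (hne : v1 ≠ v3) (h13 : ¬ G.Adj v1 v3)
    (h1x : G.Adj v1 x) (hx3 : ¬ G.Adj x v3) (w : V) (hw1 : w ≠ v1) (hwx : w ≠ x) :
    G.Adj v1 w ↔ G.Adj x w := by
  have hxne : x ≠ v3 := fun e => h13 (e ▸ h1x)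
  constructor
  · intro h
    by_contra hxw
    have hw3 : w ≠ v3 := fun e => h13 (e ▸ h)
    rcases hs.adj_left_or_right hxne hx3 w hwx hw3 with h' | h'
    · exact hxw h'
    · exact hs.cograph x v1 w v3 ⟨h1x.symm, h, h'.symm, hxw, hx3, h13⟩
  · intro h
    by_contra h1w
    have hw3 : w ≠ v3 := fun e => hx3 (e ▸ h)
    rcases hs.adj_left_or_right hne h13 w hw1 hw3 with h' | h'
    · exact h1w h'
    · exact hs.cograph v1 x w v3 ⟨h1x, h, h'.symm, h1w, h13, hx3⟩

lemma degree_twin (hs : IsRankThreeCograph G s) (hne : v1 ≠ v3) (h13 : ¬ G.Adj v1 v3)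
    (h1x : G.Adj v1 x) (hx3 : ¬ G.Adj x v3) : G.degree v1 = G.degree x :=
  degree_eq_of_adj_iff h1x (hs.twin hne h13 h1x hx3)

lemma adj_twin (hs : IsRankThreeCograph G s) (hne : v1 ≠ v3) (h13 : ¬ G.Adj v1 v3)
    (h1x : G.Adj v1 x) (hx3 : ¬ G.Adj x v3) (h12 : G.Adj v1 v2) (h32 : G.Adj v3 v2) :
    G.Adj x v2 :=
  (hs.twin hne h13 h1x hx3 v2 h12.ne' fun e => hx3 (e ▸ h32.symm)).1 h12

lemma twin_minor (hs : IsRankThreeCograph G s) (hne : v1 ≠ v3) (h13 : ¬ G.Adj v1 v3)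
    (h1x : G.Adj v1 x) (hx3 : ¬ G.Adj x v3) (h12 : G.Adj v1 v2) (h32 : G.Adj v3 v2)
    (h1y : G.Adj v1 y) (h3y : G.Adj v3 y) :
    (s * G.degree v1 - 1) * (s * G.degree v3) * (s * G.degree v2 - degShift G s v2 y) = 0 := by
  have hxne : x ≠ v3 := fun e => h13 (e ▸ h1x)
  have h := hs.minor ![v1, x, v3, v2] ![v1, v3, v2, y]
  rw [det_fin_four_of] at h
  simp only [Matrix.submatrix_apply, Matrix.cons_val, degShift_self, degShift_not_adj hne h13,
    degShift_not_adj' hne h13, degShift_adj' h1x, degShift_not_adj hxne hx3,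
    degShift_adj h12, degShift_adj' h12, degShift_adj h32, degShift_adj' h32, degShift_adj h1y,
    degShift_adj h3y, degShift_adj (hs.adj_twin hne h13 h1x hx3 h12 h32),
    degShift_adj (hs.adj_twin hne h13 h1x hx3 h1y h3y)] at h
  linear_combination h

lemma paw_minor (hs : IsRankThreeCograph G s) (hne : v1 ≠ v3) (h13 : ¬ G.Adj v1 v3)
    (h1x : G.Adj v1 x) (hx3 : ¬ G.Adj x v3) (h12 : G.Adj v1 v2) (h32 : G.Adj v3 v2) :
    (s * G.degree v1 - 1) * ((s * G.degree v1 + 1) * (s * G.degree v3 * (s * G.degree v2) - 1)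
      - 2 * (s * G.degree v3)) = 0 := by
  have hxne : x ≠ v3 := fun e => h13 (e ▸ h1x)
  have h2x := hs.adj_twin hne h13 h1x hx3 h12 h32
  have h := hs.minor ![v1, x, v3, v2] ![v1, x, v3, v2]
  rw [det_fin_four_of] at h
  simp only [Matrix.submatrix_apply, Matrix.cons_val, degShift_self, degShift_not_adj hne h13,
    degShift_not_adj' hne h13, degShift_adj h1x, degShift_adj' h1x, degShift_not_adj hxne hx3,
    degShift_not_adj' hxne hx3, degShift_adj h12, degShift_adj' h12, degShift_adj h32,
    degShift_adj' h32, degShift_adj h2x, degShift_adj' h2x,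
    ← hs.degree_twin hne h13 h1x hx3] at h
  linear_combination h

lemma principal_minor (hs : IsRankThreeCograph G s) (hne : v1 ≠ v3) (h13 : ¬ G.Adj v1 v3)
    (h12 : G.Adj v1 v2) (h32 : G.Adj v3 v2) (h1y : G.Adj v1 y) (h3y : G.Adj v3 y) :
    s * G.degree v1 * (s * G.degree v3) *
        (s * G.degree v2 * (s * G.degree y) - degShift G s v2 y ^ 2) =
      (s * G.degree v1 + s * G.degree v3) *
        (s * G.degree v2 + s * G.degree y - 2 * degShift G s v2 y) := by
  have h := hs.minor ![v1, v3, v2, y] ![v1, v3, v2, y]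
  rw [det_fin_four_of] at h
  simp only [Matrix.submatrix_apply, Matrix.cons_val, degShift_self, degShift_not_adj hne h13,
    degShift_not_adj' hne h13, degShift_adj h12, degShift_adj' h12, degShift_adj h32,
    degShift_adj' h32, degShift_adj h1y, degShift_adj' h1y, degShift_adj h3y, degShift_adj' h3y,
    degShift_comm s y v2] at h
  linear_combination h

lemma two_twins_minor (hs : IsRankThreeCograph G s) (hne : v1 ≠ v3) (h13 : ¬ G.Adj v1 v3)
    (h1x : G.Adj v1 x) (hx3 : ¬ G.Adj x v3) (h3y : G.Adj v3 y) (hy1 : ¬ G.Adj y v1)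
    (h12 : G.Adj v1 v2) (h32 : G.Adj v3 v2) :
    (s * G.degree v1 - 1) * (s * G.degree v1 + 1) * (s * G.degree v3 - 1) = 0 := by
  have hxne : x ≠ v3 := fun e => h13 (e ▸ h1x)
  have hyne : y ≠ v1 := fun e => h13 (e ▸ h3y).symm
  have h31 : ¬ G.Adj v3 v1 := fun e => h13 e.symm
  have h2x := hs.adj_twin hne h13 h1x hx3 h12 h32
  have h2y := hs.adj_twin hne.symm h31 h3y hy1 h32 h12
  have hxy : x ≠ y := fun e => hy1 (e ▸ h1x.symm)
  have hxy' : ¬ G.Adj x y := fun e =>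
    hy1 ((hs.twin hne h13 h1x hx3 y hyne hxy.symm).2 e).symm
  have h := hs.minor ![v1, x, v3, y] ![v1, x, v3, v2]
  rw [det_fin_four_of] at h
  simp only [Matrix.submatrix_apply, Matrix.cons_val, degShift_self, degShift_not_adj hne h13,
    degShift_not_adj' hne h13, degShift_adj h1x, degShift_adj' h1x, degShift_not_adj hxne hx3,
    degShift_not_adj' hxne hx3, degShift_adj h12, degShift_adj h32,
    degShift_adj h2x, degShift_adj h2y, degShift_not_adj hyne hy1, degShift_not_adj' hxy hxy',
    degShift_adj' h3y, ← hs.degree_twin hne h13 h1x hx3] at h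
  linear_combination h

lemma ne_zero (hs : IsRankThreeCograph G s) (hne : v1 ≠ v3) (h13 : ¬ G.Adj v1 v3)
    (h1x : G.Adj v1 x) (hx3 : ¬ G.Adj x v3) (h12 : G.Adj v1 v2) (h32 : G.Adj v3 v2) : s ≠ 0 := by
  rintro rfl
  have := hs.paw_minor hne h13 h1x hx3 h12 h32
  norm_num at this

lemma cast_degree_pos (hs : IsRankThreeCograph G s) (v : V) : (0 : ℝ) < G.degree v := by
  exact_mod_cast hs.degree_pos v

lemma pos_of_mul_degree_eq_one (hs : IsRankThreeCograph G s) {v : V}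
    (h : s * G.degree v = 1) : 0 < s :=
  pos_of_mul_pos_left (h ▸ one_pos) (hs.cast_degree_pos v).le

/-- If no neighbor of `v3` misses `v1`, then `v1` is adjacent to
everything except `v3`. -/
lemma degree_add_two_of_no_twin (hs : IsRankThreeCograph G s) (hne : v1 ≠ v3)
    (h13 : ¬ G.Adj v1 v3) (hno : ¬ ∃ z, G.Adj v3 z ∧ ¬ G.Adj z v1) :
    G.degree v1 + 2 = Fintype.card V := by
  refine degree_add_two_eq_card hne h13 fun w hw1 hw3 => ?_
  rcases hs.adj_left_or_right hne h13 w hw1 hw3 with h | h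
  · exact h
  · by_contra h'
    exact hno ⟨w, h, fun e => h' e.symm⟩

lemma card_le_degree_add_degree (hs : IsRankThreeCograph G s) (hne : v1 ≠ v3)
    (h13 : ¬ G.Adj v1 v3) (h12 : G.Adj v1 v2) (h32 : G.Adj v3 v2)
    (h1y : G.Adj v1 y) (h3y : G.Adj v3 y) (h2y : v2 ≠ y) :
    Fintype.card V ≤ G.degree v1 + G.degree v3 := by
  have h := degree_add_degree_add_two hne h13 (hs.adj_left_or_right hne h13)
  have h' : ({v2, y} : Finset V) ⊆ G.neighborFinset v1 ∩ G.neighborFinset v3 := by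
    intro w
    simp only [Finset.mem_insert, Finset.mem_singleton, Finset.mem_inter,
      SimpleGraph.mem_neighborFinset]
    rintro (rfl | rfl)
    · exact ⟨h12, h32⟩
    · exact ⟨h1y, h3y⟩
  have h'' := Finset.card_le_card h'
  rw [Finset.card_pair h2y] at h''
  omega

lemma adj_of_common_neighbors (hs : IsRankThreeCograph G s) (hne : v1 ≠ v3)
    (h13 : ¬ G.Adj v1 v3) (h1x : G.Adj v1 x) (hx3 : ¬ G.Adj x v3)
    (h12 : G.Adj v1 v2) (h32 : G.Adj v3 v2) (h1y : G.Adj v1 y) (h3y : G.Adj v3 y)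
    (hne2 : v2 ≠ y) : G.Adj v2 y := by
  by_contra h2y
  have h0 := hs.ne_zero hne h13 h1x hx3 h12 h32
  have h31 : ¬ G.Adj v3 v1 := fun e => h13 e.symm
  have p1 := hs.cast_degree_pos v1
  have p2 := hs.cast_degree_pos v2
  have p3 := hs.cast_degree_pos v3
  have py := hs.cast_degree_pos y
  have hA := hs.twin_minor hne h13 h1x hx3 h12 h32 h1y h3y
  have hP := hs.principal_minor hne h13 h12 h32 h1y h3y
  rw [degShift_not_adj hne2 h2y] at hA hP
  have hp : s * G.degree v1 = 1 := by
    simpa [h0, p3.ne', p2.ne', sub_eq_zero] using hA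
  have hspos := hs.pos_of_mul_degree_eq_one hp
  have q0 : 0 < s * G.degree v3 := mul_pos hspos p3
  have r0 : 0 < s * G.degree v2 := mul_pos hspos p2
  have t0 : 0 < s * G.degree y := mul_pos hspos py
  rw [hp] at hP
  by_cases hz : ∃ z, G.Adj v3 z ∧ ¬ G.Adj z v1
  · obtain ⟨z, h3z, hz1⟩ := hz
    have hA' := hs.twin_minor hne.symm h31 h3z hz1 h32 h12 h3y h1y
    rw [degShift_not_adj hne2 h2y] at hA'
    have hq : s * G.degree v3 = 1 := by
      simpa [h0, p1.ne', p2.ne', sub_eq_zero] using hA'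
    have hc : (Fintype.card V : ℝ) ≤ G.degree v1 + G.degree v3 := by
      exact_mod_cast hs.card_le_degree_add_degree hne h13 h12 h32 h1y h3y hne2
    have hd : (G.degree v2 : ℝ) < Fintype.card V := by exact_mod_cast G.degree_lt_card_verts v2
    have hr : s * G.degree v2 < 2 := by
      have := mul_lt_mul_of_pos_left (hd.trans_le hc) hspos
      linarith
    rw [hq] at hP
    nlinarith [mul_pos (sub_pos.2 hr) t0]
  · have hd1 := hs.degree_add_two_of_no_twin hne h13 hz
    have hd2 := degree_add_two_le_card hne2 h2y
    have hd3 := degree_add_two_le_card hne.symm h31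
    have hr : s * G.degree v2 ≤ 1 := by
      rw [← hp]
      exact mul_le_mul_of_nonneg_left (by exact_mod_cast (by omega)) hspos.le
    have hq : s * G.degree v3 ≤ 1 := by
      rw [← hp]
      exact mul_le_mul_of_nonneg_left (by exact_mod_cast (by omega)) hspos.le
    nlinarith [mul_nonneg t0.le (sub_nonneg.2 (mul_le_one₀ hq r0.le hr)), mul_pos q0 r0,
      mul_pos q0 t0]

lemma degree_common_neighbor (hs : IsRankThreeCograph G s) (hne : v1 ≠ v3)
    (h13 : ¬ G.Adj v1 v3) (h1x : G.Adj v1 x) (hx3 : ¬ G.Adj x v3)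
    (h12 : G.Adj v1 v2) (h32 : G.Adj v3 v2) : G.degree v2 + 1 = Fintype.card V := by
  refine degree_add_one_eq_card fun w hw => ?_
  by_contra h2w
  have hw1 : w ≠ v1 := fun e => h2w (e ▸ h12.symm)
  have hw3 : w ≠ v3 := fun e => h2w (e ▸ h32.symm)
  by_cases h1 : G.Adj v1 w
  · by_cases h3 : G.Adj v3 w
    · exact h2w (hs.adj_of_common_neighbors hne h13 h1x hx3 h12 h32 h1 h3 hw.symm)
    · exact hs.cograph v3 v2 v1 w ⟨h32, h12.symm, h1, fun e => h13 e.symm, h3, h2w⟩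
  · have h3 := (hs.adj_left_or_right hne h13 w hw1 hw3).resolve_left h1
    exact hs.cograph v1 v2 v3 w ⟨h12, h32.symm, h3, h13, h1, h2w⟩

lemma eq_of_common_neighbors (hs : IsRankThreeCograph G s) (hne : v1 ≠ v3)
    (h13 : ¬ G.Adj v1 v3) (h1x : G.Adj v1 x) (hx3 : ¬ G.Adj x v3)
    (h12 : G.Adj v1 v2) (h32 : G.Adj v3 v2) (h1y : G.Adj v1 y) (h3y : G.Adj v3 y) : v2 = y := by
  by_contra hne2
  have h2y := hs.adj_of_common_neighbors hne h13 h1x hx3 h12 h32 h1y h3y hne2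
  have h0 := hs.ne_zero hne h13 h1x hx3 h12 h32
  have h31 : ¬ G.Adj v3 v1 := fun e => h13 e.symm
  have p1 := hs.cast_degree_pos v1
  have p2 := hs.cast_degree_pos v2
  have p3 := hs.cast_degree_pos v3
  have hd2 := hs.degree_common_neighbor hne h13 h1x hx3 h12 h32
  have hdy := hs.degree_common_neighbor hne h13 h1x hx3 h1y h3y
  have hd1 := degree_add_two_le_card hne h13
  have hd3 := degree_add_two_le_card hne.symm h31
  have h2y' : G.degree y = G.degree v2 := by omega
  have h12lt : (G.degree v1 : ℝ) < G.degree v2 := by exact_mod_cast (by omega)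
  have h32lt : (G.degree v3 : ℝ) < G.degree v2 := by exact_mod_cast (by omega)
  have hA := hs.twin_minor hne h13 h1x hx3 h12 h32 h1y h3y
  have hP := hs.principal_minor hne h13 h12 h32 h1y h3y
  have hW := hs.paw_minor hne h13 h1x hx3 h12 h32
  rw [degShift_adj h2y] at hA hP
  rw [h2y'] at hP
  by_cases hr : s * G.degree v2 = 1
  · have hspos := hs.pos_of_mul_degree_eq_one hr
    have hp := mul_lt_mul_of_pos_left h12lt hspos
    have hq := mul_lt_mul_of_pos_left h32lt hspos
    have p0 := mul_pos hspos p1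
    have q0 := mul_pos hspos p3
    rw [hr] at hp hq hW
    rcases mul_eq_zero.1 hW with h | h
    · linarith
    · nlinarith [mul_pos (sub_pos.2 hp) (sub_pos.2 hq)]
  · have hp : s * G.degree v1 = 1 := by
      simpa [h0, p3.ne', sub_eq_zero, hr] using hA
    have hspos := hs.pos_of_mul_degree_eq_one hp
    rw [hp] at hP
    have hqr : s * G.degree v3 * (s * G.degree v2 - 1) = 2 := by
      apply mul_left_cancel₀ (sub_ne_zero.2 hr)
      linear_combination hP
    have hc : (Fintype.card V : ℝ) ≤ G.degree v1 + G.degree v3 := by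
      exact_mod_cast hs.card_le_degree_add_degree hne h13 h12 h32 h1y h3y hne2
    have hd2' : (G.degree v2 : ℝ) + 1 = Fintype.card V := by exact_mod_cast hd2
    by_cases hz : ∃ z, G.Adj v3 z ∧ ¬ G.Adj z v1
    · obtain ⟨z, h3z, hz1⟩ := hz
      have hA' := hs.twin_minor hne.symm h31 h3z hz1 h32 h12 h3y h1y
      rw [degShift_adj h2y] at hA'
      have hq : s * G.degree v3 = 1 := by
        simpa [h0, p1.ne', sub_eq_zero, hr] using hA'
      rw [hq] at hqr
      nlinarith
    · have hd1' := hs.degree_add_two_of_no_twin hne h13 hz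
      have hq : s * G.degree v3 ≤ 1 := by
        rw [← hp]
        exact mul_le_mul_of_nonneg_left (by exact_mod_cast (by omega)) hspos.le
      have hq0 := mul_pos hspos p3
      have hr' : s * G.degree v2 ≤ 2 := by
        have : (G.degree v2 : ℝ) ≤ G.degree v1 + G.degree v1 := by
          have := hs.degree_pos v1
          exact_mod_cast (by omega)
        nlinarith
      nlinarith

lemma degShift_row_eq (hs : IsRankThreeCograph G s) (hne : v1 ≠ v3) (h13 : ¬ G.Adj v1 v3)
    (hp : s * G.degree v1 = 1) {u : V} (hu : u = v1 ∨ G.Adj v1 u) (hu3 : ¬ G.Adj u v3) (w : V) :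
    degShift G s u w = if w = v1 ∨ G.Adj v1 w then 1 else 0 := by
  rcases hu with rfl | h1u
  · by_cases hw : w = u
    · subst hw; simp [degShift_self, hp]
    · simp [degShift, hw, Ne.symm hw]
  · by_cases hw : w = u
    · subst hw
      rw [degShift_self, ← hs.degree_twin hne h13 h1u hu3, hp, if_pos (Or.inr h1u)]
    · by_cases hw1 : w = v1
      · subst hw1
        rw [degShift_adj h1u.symm, if_pos (Or.inl rfl)]
      · simp [degShift, Ne.symm hw, hw1, hs.twin hne h13 h1u hu3 w hw1 hw]

lemma false_of_twins (hs : IsRankThreeCograph G s) (hne : v1 ≠ v3) (h13 : ¬ G.Adj v1 v3)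
    (h1x : G.Adj v1 x) (hx3 : ¬ G.Adj x v3) (h3y : G.Adj v3 y) (hy1 : ¬ G.Adj y v1)
    (h12 : G.Adj v1 v2) (h32 : G.Adj v3 v2) : False := by
  have h0 := hs.ne_zero hne h13 h1x hx3 h12 h32
  have h31 : ¬ G.Adj v3 v1 := fun e => h13 e.symm
  have p1 := hs.cast_degree_pos v1
  have p3 := hs.cast_degree_pos v3
  have hd2 := hs.degree_common_neighbor hne h13 h1x hx3 h12 h32
  have huniq (w : V) (h1 : G.Adj v1 w) (h3 : G.Adj v3 w) : w = v2 :=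
    (hs.eq_of_common_neighbors hne h13 h1x hx3 h12 h32 h1 h3).symm
  have hsum : G.degree v2 = G.degree v1 + G.degree v3 := by
    have h := degree_add_degree_add_two hne h13 (hs.adj_left_or_right hne h13)
    have he : G.neighborFinset v1 ∩ G.neighborFinset v3 = {v2} := by
      ext w
      simp only [Finset.mem_inter, SimpleGraph.mem_neighborFinset, Finset.mem_singleton]
      exact ⟨fun hw => huniq w hw.1 hw.2, fun hw => hw ▸ ⟨h12, h32⟩⟩
    rw [he, Finset.card_singleton] at h
    omega
  have hr : s * G.degree v2 = s * G.degree v1 + s * G.degree v3 := by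
    rw [hsum]; push_cast; ring
  have hW := hs.paw_minor hne h13 h1x hx3 h12 h32
  have hW' := hs.paw_minor hne.symm h31 h3y hy1 h32 h12
  have key {p q : ℝ} (hp : p = 1) (hq0 : 0 < q)
      (h : (q - 1) * ((q + 1) * (p * (p + q) - 1) - 2 * p) = 0) : q = 1 := by
    subst hp
    have h' : (q - 1) ^ 2 * (q + 2) = 0 := by linear_combination h
    have h'' : q + 2 ≠ 0 := by positivity
    simpa [h'', sub_eq_zero] using h'
  have hpq : s * G.degree v1 = 1 ∧ s * G.degree v3 = 1 := by
    have hT := hs.two_twins_minor hne h13 h1x hx3 h3y hy1 h12 h32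
    rw [hr] at hW hW'
    rcases mul_eq_zero.1 hT with hT | hT
    · rcases mul_eq_zero.1 hT with hT | hT
      · have hp := sub_eq_zero.1 hT
        exact ⟨hp, key hp (mul_pos (hs.pos_of_mul_degree_eq_one hp) p3) hW'⟩
      · have hp : s * G.degree v1 = -1 := by linarith
        rw [hp] at hW
        have : s * G.degree v3 = 0 := by linear_combination hW / 4
        exact absurd this (mul_ne_zero h0 p3.ne')
    · have hq := sub_eq_zero.1 hT
      refine ⟨key hq (mul_pos (hs.pos_of_mul_degree_eq_one hq) p1) ?_, hq⟩
      rw [add_comm (s * (G.degree v3 : ℝ))]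
      exact hW
  obtain ⟨hp, hq⟩ := hpq
  let C : Matrix V Bool ℝ := Matrix.of fun u i =>
    if u = cond i v1 v3 ∨ G.Adj (cond i v1 v3) u then 1 else 0
  have hC : degShift G s = C * Cᵀ := by
    have hcases (w : V) (hw : w ≠ v2) :
        ((w = v1 ∨ G.Adj v1 w) ∧ ¬ (w = v3 ∨ G.Adj v3 w)) ∨
          (¬ (w = v1 ∨ G.Adj v1 w) ∧ (w = v3 ∨ G.Adj v3 w)) := by
      have e1 := hs.adj_left_or_right hne h13 w
      have e2 := huniq w
      by_cases hw1 : w = v1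
      · subst hw1; exact Or.inl ⟨Or.inl rfl, by simp [hne, h31]⟩
      by_cases hw3 : w = v3
      · subst hw3; exact Or.inr ⟨by simp [hne.symm, h13], Or.inl rfl⟩
      tauto
    ext u w
    simp only [Matrix.mul_apply, Fintype.sum_bool, C, Matrix.transpose_apply, Matrix.of_apply,
      cond_true, cond_false]
    by_cases hu : u = v2
    · subst hu
      by_cases hw : w = u
      · subst hw
        rw [degShift_self, hr, hp, hq]
        simp [h12, h32]
      · have hadj : G.Adj u w := by
          by_contra h'
          have := degree_add_two_le_card (Ne.symm hw) h'
          omega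
        rw [degShift_adj hadj]
        rcases hcases w hw with ⟨h, h'⟩ | ⟨h, h'⟩ <;> simp [h, h', h12, h32]
    · rcases hcases u hu with ⟨h, h'⟩ | ⟨h, h'⟩
      · rw [hs.degShift_row_eq hne h13 hp h fun e => h' (Or.inr e.symm)]
        simp [h, h']
      · rw [hs.degShift_row_eq hne.symm h31 hq h' fun e => h (Or.inr e.symm)]
        simp [h, h']
  have hrank := (Matrix.rank_mul_le_left C Cᵀ).trans (Matrix.rank_le_card_width C)
  rw [← hC, hs.rank_eq, Fintype.card_bool] at hrank
  omega

end IsRankThreeCograph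

lemma adj_or_of_indepNum_eq_two {V : Type*} [Fintype V] [DecidableEq V] {G : SimpleGraph V}
    (h : indepNum G = 2) (a b c : V) (hab : a ≠ b) (hac : a ≠ c) (hbc : b ≠ c) :
    G.Adj a b ∨ G.Adj a c ∨ G.Adj b c := by
  by_contra! hn
  obtain ⟨n1, n2, n3⟩ := hn
  have hle : 3 ≤ indepNum G := by
    refine le_csSup ⟨Fintype.card V, ?_⟩ ⟨{a, b, c}, ?_, Finset.card_eq_three.2
      ⟨a, b, c, hab, hac, hbc, rfl⟩⟩
    · rintro k ⟨t, -, rfl⟩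
      exact Finset.card_le_univ t
    · intro u hu v hv huv
      simp only [Finset.mem_insert, Finset.mem_singleton] at hu hv
      rcases hu with rfl | rfl | rfl <;> rcases hv with rfl | rfl | rfl <;>
        simp_all [G.adj_comm]
  omega

lemma exists_isRankThreeCograph {V : Type*} [Fintype V] [DecidableEq V] {n : ℕ} (hn : 5 ≤ n)
    {G : SimpleGraph V} [DecidableRel G.Adj] (hG : memG1Family G n) (hco : IsCograph G) :
    ∃ s, IsRankThreeCograph G s := by
  obtain ⟨hconn, hcard, ⟨θ, hθ⟩, -, hind⟩ := hG
  have : Nontrivial V := Fintype.one_lt_card_iff_nontrivial.1 (by omega)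
  have hdeg (v : V) : 0 < G.degree v := hconn.preconnected.degree_pos_of_nontrivial v
  have h := rank_degShift G hdeg θ
  exact ⟨θ - 1, hdeg, hco, adj_or_of_indepNum_eq_two hind, by omega⟩

lemma adj_iff_mem_of_mem_Sset {V : Type*} {G : SimpleGraph V} {P U : Set V} {u w : V}
    (hu : u ∈ Sset G P U) (hw : w ∈ P) : G.Adj u w ↔ w ∈ U := by
  rw [← hu.2]
  simp [hw]

theorem statement11 {V : Type*} [Fintype V] [DecidableEq V] (n : ℕ) (hn : 5 ≤ n)
    (G : SimpleGraph V) [DecidableRel G.Adj]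
    (hG : memG1Family G n) (hco : IsCograph G) (hdiam : G.diam = 2)
    (v1 v2 v3 : V) (h12 : G.Adj v1 v2) (h23 : G.Adj v2 v3) (hdist : G.dist v1 v3 = 2) :
    (Sset G {v1, v2, v3} {v1, v2}).Nonempty →
      Sset G {v1, v2, v3} {v1, v3} = ∅ ∧
      Sset G {v1, v2, v3} {v2, v3} = ∅ ∧
      Sset G {v1, v2, v3} {v1, v2, v3} = ∅ := by
  rintro ⟨x, hx⟩
  obtain ⟨s, hs⟩ := exists_isRankThreeCograph hn hG hco
  have hne : v1 ≠ v3 := by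
    rintro rfl
    simp at hdist
  have h13 : ¬ G.Adj v1 v3 := fun h => by
    rw [SimpleGraph.dist_eq_one_iff_adj.2 h] at hdist
    omega
  have h1x : G.Adj v1 x := ((adj_iff_mem_of_mem_Sset hx (by simp)).2 (by simp)).symm
  have hx3 : ¬ G.Adj x v3 := fun h => by
    have := (adj_iff_mem_of_mem_Sset hx (by simp)).1 h
    simp [hne.symm, h23.ne'] at this
  have hnot (y : V) (hy : y ∉ ({v1, v2, v3} : Set V)) (h1 : G.Adj y v1) (h3 : G.Adj y v3) :
      False := by
    have := hs.eq_of_common_neighbors hne h13 h1x hx3 h12 h23.symm h1.symm h3.symm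
    simp [← this] at hy
  refine ⟨Set.eq_empty_iff_forall_notMem.2 fun y hy => ?_,
    Set.eq_empty_iff_forall_notMem.2 fun y hy => ?_,
    Set.eq_empty_iff_forall_notMem.2 fun y hy => ?_⟩
  · exact hnot y hy.1 ((adj_iff_mem_of_mem_Sset hy (by simp)).2 (by simp))
      ((adj_iff_mem_of_mem_Sset hy (by simp)).2 (by simp))
  · refine hs.false_of_twins hne h13 h1x hx3
      ((adj_iff_mem_of_mem_Sset hy (by simp)).2 (by simp)).symm (fun h => ?_) h12 h23.symm
    have := (adj_iff_mem_of_mem_Sset hy (by simp)).1 h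
    simp [hne, h12.ne] at this
  · exact hnot y hy.1 ((adj_iff_mem_of_mem_Sset hy (by simp)).2 (by simp))
      ((adj_iff_mem_of_mem_Sset hy (by simp)).2 (by simp))
end
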